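/- Let k ≥ 2 be an integer and let 0 < α < 1 be a real number. Let g : A_k^ℕ → ℝ be continuous and positive, let h : A_k^ℕ → ℝ be continuous and vanish identically on Σ_{s_k}, and define V(x) = (g(x) + h(x))/δ_{s_k}(x)^α for δ_{s_k}(x) < ∞ and V(x) = 0 on Σ_{s_k}; assume V ≥ 0. Then for every x ∈ A_k^ℕ \ Σ_{s_k}, (R^n V)(x) → +∞ as n → ∞. -/

import Mathlib

/-- The `k`-bonacci substitution on letters: `a ↦ 0(a+1)` if `a ≠ k-1`, and `k-1 ↦ 0`. -/
def sLetter {k : ℕ} (a : Fin k) : List (Fin k) :=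
  if h : (a : ℕ) + 1 < k then
    [⟨0, Nat.lt_of_le_of_lt (Nat.zero_le _) a.isLt⟩, ⟨(a : ℕ) + 1, h⟩]
  else
    [⟨0, Nat.lt_of_le_of_lt (Nat.zero_le _) a.isLt⟩]

/-- Extension of the substitution to finite words by concatenation. -/
def sWord {k : ℕ} (w : List (Fin k)) : List (Fin k) := w.flatMap sLetter

/-- The prefix of length `n` of a right-infinite sequence. -/
def pref {k : ℕ} (x : ℕ → Fin k) (n : ℕ) : List (Fin k) :=
  (List.range n).map x

/-- Extension of the substitution to right-infinite sequences, by concatenating the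
images of the letters: since each letter has a nonempty image, the `m`-th letter of the
image is the `m`-th letter of the image of the prefix of length `m+1`. -/
def sSeq {k : ℕ} (x : ℕ → Fin k) : ℕ → Fin k :=
  fun m => (sWord (pref x (m + 1))).getD m (x 0)

/-- The left shift on sequences. -/
def shift {k : ℕ} (x : ℕ → Fin k) : ℕ → Fin k := fun n => x (n + 1)

/-- The language of the substitution: finite words occurring as a subword of some `s^m(a)`. -/
def Lang {k : ℕ} (w : List (Fin k)) : Prop :=
  ∃ (a : Fin k) (m : ℕ), w <:+: sWord^[m] [a]

/-- `delta x = sup {n : prefix of x of length n is in the language}`, valued in `ℕ∞`. -/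
noncomputable def delta {k : ℕ} (x : ℕ → Fin k) : ℕ∞ :=
  sSup {N : ℕ∞ | ∃ n : ℕ, N = (n : ℕ∞) ∧ Lang (pref x n)}

/-- The subshift associated to the substitution: sequences all of whose subwords
lie in the language. -/
def Attr (k : ℕ) : Set (ℕ → Fin k) :=
  {x | ∀ i n, Lang ((List.range n).map (fun j => x (i + j)))}

/-- The renormalization operator. -/
noncomputable def Renorm {k : ℕ} (V : (ℕ → Fin k) → ℝ) : (ℕ → Fin k) → ℝ :=
  fun x => ∑ j ∈ Finset.range (sLetter (x 0)).length, V (shift^[j] (sSeq x))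

/-- `vcoef k lam l = lam^{-(k-1-l)} * ∑_{j=0}^{k-1-l} lam^j`. -/
noncomputable def vcoef (k : ℕ) (lam : ℝ) (l : ℕ) : ℝ :=
  (∑ j ∈ Finset.range (k - l), lam ^ j) / lam ^ (k - 1 - l)

/-- The fixed point of the renormalization operator. -/
noncomputable def Ufix (k : ℕ) (lam : ℝ) (x : ℕ → Fin k) : ℝ :=
  if delta x = ⊤ then 0
  else Real.log (1 + vcoef k lam (x 0) /
    (lam / (lam - 1)
      + (∑ l : Fin k, vcoef k lam (l : ℕ) * ((pref x (delta x).toNat).count l : ℝ))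
      - vcoef k lam (x 0)))

/-- The word `s^n(0) · s^{n-1}(0) ⋯ s(0) · 0`. -/
def bword {k : ℕ} (z : Fin k) (n : ℕ) : List (Fin k) :=
  ((List.range (n + 1)).map (fun i => sWord^[n - i] [z])).flatten

/-- The word `s^{n-1}(0) · s^{n-2}(0) ⋯ s(0) · 0`. -/
def bsuffix {k : ℕ} (z : Fin k) (n : ℕ) : List (Fin k) :=
  ((List.range n).map (fun i => sWord^[n - 1 - i] [z])).flatten

section Words

variable {k : ℕ}

lemma sWord_append (u v : List (Fin k)) : sWord (u ++ v) = sWord u ++ sWord v := by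
  simp [sWord]

lemma sWord_cons (a : Fin k) (v : List (Fin k)) : sWord (a :: v) = sLetter a ++ sWord v := by
  simp [sWord]

lemma sWord_iterate_append (n : ℕ) (u v : List (Fin k)) :
    sWord^[n] (u ++ v) = sWord^[n] u ++ sWord^[n] v := by
  induction n generalizing u v with
  | zero => rfl
  | succ n ih => simp only [Function.iterate_succ_apply, sWord_append, ih]

lemma sWord_iterate_cons (n : ℕ) (a : Fin k) (v : List (Fin k)) :
    sWord^[n] (a :: v) = sWord^[n] [a] ++ sWord^[n] v := by
  rw [← sWord_iterate_append, List.singleton_append]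

lemma sWord_iterate_nil (n : ℕ) : sWord^[n] ([] : List (Fin k)) = [] := by
  induction n with
  | zero => rfl
  | succ n ih => rw [Function.iterate_succ_apply]; exact ih

lemma sLetter_of_lt {z a : Fin k} (hz : (z : ℕ) = 0) (h : (a : ℕ) + 1 < k) :
    sLetter a = [z, ⟨a + 1, h⟩] := by
  have : z = ⟨0, Nat.lt_of_le_of_lt (Nat.zero_le _) a.isLt⟩ := Fin.ext hz
  simp [sLetter, h, this]

lemma sLetter_of_not_lt {z a : Fin k} (hz : (z : ℕ) = 0) (h : ¬ (a : ℕ) + 1 < k) :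
    sLetter a = [z] := by
  have : z = ⟨0, Nat.lt_of_le_of_lt (Nat.zero_le _) a.isLt⟩ := Fin.ext hz
  simp [sLetter, h, this]

lemma length_le_length_sWord (w : List (Fin k)) : w.length ≤ (sWord w).length := by
  induction w with
  | nil => simp
  | cons a w ih =>
    have : 1 ≤ (sLetter a).length := by unfold sLetter; split <;> simp
    rw [sWord_cons, List.length_append, List.length_cons]
    omega

lemma length_le_length_sWord_iterate (n : ℕ) (w : List (Fin k)) :
    w.length ≤ (sWord^[n] w).length := by
  induction n with
  | zero => rfl
  | succ n ih =>
    rw [Function.iterate_succ_apply']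
    exact ih.trans (length_le_length_sWord _)

lemma length_pref (x : ℕ → Fin k) (n : ℕ) : (pref x n).length = n := by simp [pref]

lemma getElem?_pref {x : ℕ → Fin k} {n i : ℕ} (h : i < n) : (pref x n)[i]? = some (x i) := by
  simp [pref, h]

lemma eq_pref_of_getElem? {x : ℕ → Fin k} {w : List (Fin k)}
    (h : ∀ i < w.length, w[i]? = some (x i)) : w = pref x w.length := by
  refine List.ext_getElem? fun i => ?_
  rcases lt_or_ge i w.length with hi | hi
  · rw [h i hi, getElem?_pref hi]
  · rw [List.getElem?_eq_none hi, List.getElem?_eq_none (by rwa [length_pref])]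

lemma pref_succ (x : ℕ → Fin k) (n : ℕ) : pref x (n + 1) = x 0 :: pref (shift x) n := by
  simp [pref, shift, List.range_succ_eq_map, Function.comp_def]

lemma pref_add (x : ℕ → Fin k) (m n : ℕ) :
    pref x (m + n) = pref x m ++ (List.range n).map (fun j => x (m + j)) := by
  simp [pref, List.range_add, Function.comp_def]

lemma pref_prefix (x : ℕ → Fin k) {m n : ℕ} (h : m ≤ n) : pref x m <+: pref x n := by
  obtain ⟨d, rfl⟩ := Nat.exists_eq_add_of_le h
  rw [pref_add]
  exact List.prefix_append _ _

lemma shift_iterate_apply (x : ℕ → Fin k) (j i : ℕ) : shift^[j] x i = x (j + i) := by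
  induction j generalizing x with
  | zero => simp
  | succ j ih => rw [Function.iterate_succ_apply, ih, shift]; congr 1; omega

lemma pref_shift_iterate (x : ℕ → Fin k) (j n : ℕ) :
    pref (shift^[j] x) n = (pref x (j + n)).drop j := by
  have : (pref x j).length = j := length_pref x j
  rw [pref_add, List.drop_left' this]
  simp [pref, shift_iterate_apply]

lemma getElem?_sWord_pref {x : ℕ → Fin k} {m i : ℕ} (h : i < (sWord (pref x m)).length) :
    (sWord (pref x m))[i]? = some (sSeq x i) := by
  have hi : i < (sWord (pref x (i + 1))).length := by
    have := length_le_length_sWord (pref x (i + 1))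
    rw [length_pref] at this
    omega
  have hmono : ∀ {p q : ℕ}, p ≤ q → sWord (pref x p) <+: sWord (pref x q) := by
    intro p q hpq
    obtain ⟨t, ht⟩ := pref_prefix x hpq
    exact ⟨sWord t, by rw [← sWord_append, ht]⟩
  have key : (sWord (pref x m))[i]? = (sWord (pref x (i + 1)))[i]? := by
    rcases le_total m (i + 1) with hm | hm
    · obtain ⟨t, ht⟩ := hmono hm
      rw [← ht, List.getElem?_append_left h]
    · obtain ⟨t, ht⟩ := hmono hm
      rw [← ht, List.getElem?_append_left hi]
  rw [key, sSeq, List.getD_eq_getElem?_getD, List.getElem?_eq_getElem hi]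
  rfl

lemma getElem?_sWord_iterate_pref (n : ℕ) {x : ℕ → Fin k} {m i : ℕ}
    (h : i < (sWord^[n] (pref x m)).length) :
    (sWord^[n] (pref x m))[i]? = some (sSeq^[n] x i) := by
  induction n generalizing x m with
  | zero =>
    rw [Function.iterate_zero, id, length_pref] at h
    exact getElem?_pref h
  | succ n ih =>
    have e : sWord (pref x m) = pref (sSeq x) (sWord (pref x m)).length :=
      eq_pref_of_getElem? fun i hi => getElem?_sWord_pref hi
    rw [Function.iterate_succ_apply] at h ⊢
    rw [Function.iterate_succ_apply]
    rw [e] at h ⊢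
    exact ih h

lemma sSeq_iterate_shift (n : ℕ) (x : ℕ → Fin k) :
    sSeq^[n] (shift x) = shift^[(sWord^[n] [x 0]).length] (sSeq^[n] x) := by
  funext i
  rw [shift_iterate_apply]
  have h1 : i < (sWord^[n] (pref (shift x) (i + 1))).length := by
    have := length_le_length_sWord_iterate n (pref (shift x) (i + 1))
    rw [length_pref] at this
    omega
  have h2 : sWord^[n] (pref x (i + 2)) =
      sWord^[n] [x 0] ++ sWord^[n] (pref (shift x) (i + 1)) := by
    rw [pref_succ, sWord_iterate_cons]
  have h3 := getElem?_sWord_iterate_pref n (x := x) (m := i + 2)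
    (i := (sWord^[n] [x 0]).length + i) (by rw [h2, List.length_append]; omega)
  rw [h2, List.getElem?_append_right (Nat.le_add_right _ _), Nat.add_sub_cancel_left,
    getElem?_sWord_iterate_pref n h1] at h3
  exact Option.some_injective _ h3

lemma sSeq_zero {z : Fin k} (hz : (z : ℕ) = 0) (x : ℕ → Fin k) : sSeq x 0 = z := by
  have h : pref x 1 = [x 0] := rfl
  have h1 : (sWord (pref x 1))[0]? = some z := by
    rw [h, sWord_cons]
    by_cases hx : (x 0 : ℕ) + 1 < k
    · simp [sLetter_of_lt hz hx]
    · simp [sLetter_of_not_lt hz hx]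
  have := length_le_length_sWord (pref x 1)
  rw [getElem?_sWord_pref (by rw [length_pref] at this; omega)] at h1
  exact Option.some_injective _ h1

lemma sSeq_one {x : ℕ → Fin k} (hx : (x 0 : ℕ) + 1 < k) : sSeq x 1 = ⟨x 0 + 1, hx⟩ := by
  have h : sWord (pref x 1) = [⟨0, by omega⟩, ⟨x 0 + 1, hx⟩] := by
    have h : pref x 1 = [x 0] := rfl
    rw [h, sWord_cons, sLetter_of_lt (z := ⟨0, by omega⟩) rfl hx]
    rfl
  have h1 := getElem?_sWord_pref (x := x) (m := 1) (i := 1) (by simp [h])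
  rw [h] at h1
  exact (Option.some_injective _ h1).symm

lemma length_sWord_iterate_succ_of_lt {z a : Fin k} (hz : (z : ℕ) = 0) (h : (a : ℕ) + 1 < k)
    (n : ℕ) : (sWord^[n + 1] [a]).length =
      (sWord^[n] [z]).length + (sWord^[n] [(⟨a + 1, h⟩ : Fin k)]).length := by
  rw [Function.iterate_succ_apply, sWord_cons, sLetter_of_lt hz h, ← List.length_append,
    ← sWord_iterate_append]
  rfl

lemma length_sWord_iterate_succ_of_not_lt {z a : Fin k} (hz : (z : ℕ) = 0)
    (h : ¬ (a : ℕ) + 1 < k) (n : ℕ) :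
    (sWord^[n + 1] [a]).length = (sWord^[n] [z]).length := by
  rw [Function.iterate_succ_apply, sWord_cons, sLetter_of_not_lt hz h]
  rfl

/-- Iterates of the renormalization operator are Birkhoff sums along iterates of the
substitution. -/
lemma Renorm_iterate_apply (V : (ℕ → Fin k) → ℝ) (n : ℕ) (x : ℕ → Fin k) :
    Renorm^[n] V x =
      ∑ j ∈ Finset.range (sWord^[n] [x 0]).length, V (shift^[j] (sSeq^[n] x)) := by
  induction n generalizing x with
  | zero => simp
  | succ n ih =>
    have hz : ((⟨0, (x 0).pos⟩ : Fin k) : ℕ) = 0 := rfl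
    rw [Function.iterate_succ_apply', Renorm]
    by_cases hx : (x 0 : ℕ) + 1 < k
    · rw [length_sWord_iterate_succ_of_lt hz hx, Finset.sum_range_add, sLetter_of_lt hz hx]
      simp only [List.length_cons, List.length_nil, zero_add, Finset.sum_range_succ,
        Finset.sum_range_zero, Function.iterate_zero, id, Nat.reduceAdd, Function.iterate_one]
      rw [ih, ih, sSeq_zero hz, sSeq_iterate_shift, sSeq_zero hz]
      have h1 : shift (sSeq x) 0 = ⟨x 0 + 1, hx⟩ := sSeq_one hx
      rw [h1]
      congr 1
      refine Finset.sum_congr rfl fun j _ => ?_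
      rw [← Function.iterate_add_apply, add_comm j]
      rfl
    · rw [length_sWord_iterate_succ_of_not_lt hz hx, sLetter_of_not_lt hz hx]
      simp only [List.length_cons, List.length_nil, zero_add, Finset.sum_range_one,
        Function.iterate_zero, id]
      rw [ih, sSeq_zero hz]
      rfl

/-! ### Growth of the lengths of the iterated words -/

lemma length_sWord_iterate_antitone (n : ℕ) {a b : Fin k} (hab : a ≤ b) :
    (sWord^[n] [b]).length ≤ (sWord^[n] [a]).length := by
  induction n generalizing a b with
  | zero => simp
  | succ n ih =>
    have hz : ((⟨0, a.pos⟩ : Fin k) : ℕ) = 0 := rfl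
    have hab' : (a : ℕ) ≤ b := hab
    by_cases hb : (b : ℕ) + 1 < k
    · have ha : (a : ℕ) + 1 < k := by omega
      rw [length_sWord_iterate_succ_of_lt hz hb, length_sWord_iterate_succ_of_lt hz ha]
      have := ih (a := ⟨a + 1, ha⟩) (b := ⟨b + 1, hb⟩) (by simpa using hab)
      omega
    · rw [length_sWord_iterate_succ_of_not_lt hz hb]
      by_cases ha : (a : ℕ) + 1 < k
      · rw [length_sWord_iterate_succ_of_lt hz ha]
        omega
      · rw [length_sWord_iterate_succ_of_not_lt hz ha]

lemma length_sWord_iterate_le_zero {z : Fin k} (hz : (z : ℕ) = 0) (n : ℕ) (a : Fin k) :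
    (sWord^[n] [a]).length ≤ (sWord^[n] [z]).length :=
  length_sWord_iterate_antitone n (by rw [Fin.le_def, hz]; exact Nat.zero_le _)

lemma length_sWord_iterate_zero_le_succ {z : Fin k} (hz : (z : ℕ) = 0) (n : ℕ) (a : Fin k) :
    (sWord^[n] [z]).length ≤ (sWord^[n + 1] [a]).length := by
  by_cases ha : (a : ℕ) + 1 < k
  · rw [length_sWord_iterate_succ_of_lt hz ha]
    omega
  · rw [length_sWord_iterate_succ_of_not_lt hz ha]

lemma length_sWord_iterate_succ_le {z : Fin k} (hz : (z : ℕ) = 0) (n : ℕ) (a : Fin k) :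
    (sWord^[n + 1] [a]).length ≤ 2 * (sWord^[n] [z]).length := by
  by_cases ha : (a : ℕ) + 1 < k
  · rw [length_sWord_iterate_succ_of_lt hz ha]
    have := length_sWord_iterate_le_zero hz n ⟨a + 1, ha⟩
    omega
  · rw [length_sWord_iterate_succ_of_not_lt hz ha]
    omega

lemma length_sWord_iterate_zero_le {z : Fin k} (hz : (z : ℕ) = 0) (n : ℕ) (a : Fin k) :
    (sWord^[n] [z]).length ≤ 2 * (sWord^[n] [a]).length := by
  cases n with
  | zero => simp
  | succ n =>
    have h1 := length_sWord_iterate_succ_le hz n z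
    have h2 := length_sWord_iterate_zero_le_succ hz n a
    omega

lemma sum_length_sWord_iterate_le (hk : 2 ≤ k) {z : Fin k} (hz : (z : ℕ) = 0) (n : ℕ) :
    ∑ i ∈ Finset.range n, (sWord^[i] [z]).length ≤ (sWord^[n + 1] [z]).length := by
  induction n with
  | zero => simp
  | succ n ih =>
    have hz1 : (z : ℕ) + 1 < k := by omega
    have h1 := length_sWord_iterate_succ_of_lt hz hz1 (n + 1)
    have h2 := length_sWord_iterate_zero_le_succ hz n ⟨z + 1, hz1⟩
    rw [Finset.sum_range_succ]
    omega

lemma lt_length_sWord_iterate_zero (hk : 2 ≤ k) {z : Fin k} (hz : (z : ℕ) = 0) (n : ℕ) :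
    n < (sWord^[n] [z]).length := by
  induction n with
  | zero => simp
  | succ n ih =>
    have hz1 : (z : ℕ) + 1 < k := by omega
    have h1 := length_sWord_iterate_succ_of_lt hz hz1 n
    have h2 := length_le_length_sWord_iterate n [(⟨z + 1, hz1⟩ : Fin k)]
    rw [List.length_singleton] at h2
    omega

lemma length_sWord_iterate_le_mul {z : Fin k} (hz : (z : ℕ) = 0) (n : ℕ) (w : List (Fin k)) :
    (sWord^[n] w).length ≤ w.length * (sWord^[n] [z]).length := by
  induction w with
  | nil => simp [sWord_iterate_nil]
  | cons a w ih =>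
    have := length_sWord_iterate_le_zero hz n a
    rw [sWord_iterate_cons, List.length_append, List.length_cons, Nat.succ_mul]
    omega

/-! ### Desubstitution -/

lemma sWord_eq_nil_or_cons {z : Fin k} (hz : (z : ℕ) = 0) (w : List (Fin k)) :
    sWord w = [] ∨ ∃ t, sWord w = z :: t := by
  cases w with
  | nil => exact Or.inl rfl
  | cons a w =>
    right
    rw [sWord_cons]
    by_cases ha : (a : ℕ) + 1 < k
    · exact ⟨_, by rw [sLetter_of_lt hz ha]; rfl⟩
    · exact ⟨_, by rw [sLetter_of_not_lt hz ha]; rfl⟩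

lemma exists_sWord_append_eq_cons {z : Fin k} (hz : (z : ℕ) = 0) (w : List (Fin k)) :
    ∃ t, sWord w ++ [z] = z :: t := by
  rcases sWord_eq_nil_or_cons hz w with h | ⟨t, h⟩
  · exact ⟨[], by rw [h]; rfl⟩
  · exact ⟨t ++ [z], by rw [h]; rfl⟩

lemma prefix_of_sWord_append_prefix {z : Fin k} (hz : (z : ℕ) = 0) {w u : List (Fin k)}
    (h : sWord w ++ [z] <+: sWord u) : w <+: u := by
  induction w generalizing u with
  | nil => exact List.nil_prefix
  | cons a w ih =>
    have hne : ∀ (b : Fin k) (hb : (b : ℕ) + 1 < k), z ≠ ⟨b + 1, hb⟩ := by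
      intro b hb e
      have := congrArg Fin.val e
      simp [hz] at this
    cases u with
    | nil => simp [sWord] at h
    | cons b u =>
      rw [sWord_cons, sWord_cons, List.append_assoc] at h
      by_cases ha : (a : ℕ) + 1 < k <;> by_cases hb : (b : ℕ) + 1 < k
      · rw [sLetter_of_lt hz ha, sLetter_of_lt hz hb] at h
        simp only [List.cons_append, List.nil_append, List.cons_prefix_cons, true_and,
          Fin.mk.injEq, Nat.add_right_cancel_iff] at h
        exact List.cons_prefix_cons.2 ⟨Fin.ext h.1, ih h.2⟩
      · rw [sLetter_of_lt hz ha, sLetter_of_not_lt hz hb] at h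
        simp only [List.cons_append, List.nil_append, List.cons_prefix_cons, true_and] at h
        rcases sWord_eq_nil_or_cons hz u with h' | ⟨t, h'⟩
        · simp [h'] at h
        · rw [h', List.cons_prefix_cons] at h
          exact absurd h.1.symm (hne a ha)
      · rw [sLetter_of_not_lt hz ha, sLetter_of_lt hz hb] at h
        simp only [List.cons_append, List.nil_append, List.cons_prefix_cons, true_and] at h
        obtain ⟨t, h'⟩ := exists_sWord_append_eq_cons hz w
        rw [h', List.cons_prefix_cons] at h
        exact absurd h.1 (hne b hb)
      · rw [sLetter_of_not_lt hz ha, sLetter_of_not_lt hz hb] at h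
        simp only [List.cons_append, List.nil_append, List.cons_prefix_cons, true_and] at h
        exact List.cons_prefix_cons.2 ⟨Fin.ext (by omega), ih h⟩

lemma infix_of_sWord_append_infix {z : Fin k} (hz : (z : ℕ) = 0) {w u : List (Fin k)}
    (h : sWord w ++ [z] <:+: sWord u) : w <:+: u := by
  induction u with
  | nil => simp [sWord] at h
  | cons b u ih =>
    by_cases hp : sWord w ++ [z] <+: sWord (b :: u)
    · exact (prefix_of_sWord_append_prefix hz hp).isInfix
    · suffices sWord w ++ [z] <:+: sWord u from List.infix_cons (ih this)
      rw [sWord_cons] at h hp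
      by_cases hb : (b : ℕ) + 1 < k
      · rw [sLetter_of_lt hz hb] at h hp
        simp only [List.cons_append, List.nil_append] at h hp
        rw [List.infix_cons_iff, List.infix_cons_iff] at h
        rcases h with h | h | h
        · exact absurd h hp
        · obtain ⟨t, h'⟩ := exists_sWord_append_eq_cons hz w
          rw [h', List.cons_prefix_cons] at h
          have := congrArg Fin.val h.1
          simp [hz] at this
        · exact h
      · rw [sLetter_of_not_lt hz hb] at h hp
        simp only [List.cons_append, List.nil_append] at h hp
        rw [List.infix_cons_iff] at h
        exact h.resolve_left hp

lemma infix_of_succ_cons_sWord_append_infix {z : Fin k} (hz : (z : ℕ) = 0) {a : Fin k}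
    (ha : (a : ℕ) + 1 < k) {w u : List (Fin k)}
    (h : (⟨a + 1, ha⟩ : Fin k) :: (sWord w ++ [z]) <:+: sWord u) : a :: w <:+: u := by
  have hne : (⟨a + 1, ha⟩ : Fin k) ≠ z := by
    intro e
    have := congrArg Fin.val e
    simp [hz] at this
  induction u with
  | nil => simp [sWord] at h
  | cons b u ih =>
    rw [sWord_cons] at h
    by_cases hb : (b : ℕ) + 1 < k
    · rw [sLetter_of_lt hz hb] at h
      simp only [List.cons_append, List.nil_append] at h
      rw [List.infix_cons_iff, List.infix_cons_iff, List.cons_prefix_cons,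
        List.cons_prefix_cons] at h
      rcases h with h | h | h
      · exact absurd h.1 hne
      · have hab : a = b := Fin.ext (by simpa using h.1)
        exact (List.cons_prefix_cons.2 ⟨hab, prefix_of_sWord_append_prefix hz h.2⟩).isInfix
      · exact List.infix_cons (ih h)
    · rw [sLetter_of_not_lt hz hb] at h
      simp only [List.cons_append, List.nil_append] at h
      rw [List.infix_cons_iff, List.cons_prefix_cons] at h
      rcases h with h | h
      · exact absurd h.1 hne
      · exact List.infix_cons (ih h)

/-! ### The language -/

lemma Lang.of_infix {v w : List (Fin k)} (hw : Lang w) (h : v <:+: w) : Lang v := by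
  obtain ⟨a, m, hm⟩ := hw
  exact ⟨a, m, h.trans hm⟩

lemma Lang.exists_infix_sWord {w : List (Fin k)} (hw : Lang w) (h : 2 ≤ w.length) :
    ∃ (a : Fin k) (m : ℕ), w <:+: sWord (sWord^[m] [a]) := by
  obtain ⟨a, m, hm⟩ := hw
  cases m with
  | zero =>
    have := hm.length_le
    rw [Function.iterate_zero, id, List.length_singleton] at this
    omega
  | succ m => exact ⟨a, m, by rwa [Function.iterate_succ_apply'] at hm⟩

lemma Lang.of_sWord_append {z : Fin k} (hz : (z : ℕ) = 0) {w : List (Fin k)} (hne : w ≠ [])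
    (h : Lang (sWord w ++ [z])) : Lang w := by
  have h1 := List.length_pos_iff.2 hne
  have h2 := length_le_length_sWord w
  obtain ⟨b, m, hm⟩ := h.exists_infix_sWord (by
    rw [List.length_append, List.length_singleton]; omega)
  exact ⟨b, m, infix_of_sWord_append_infix hz hm⟩

lemma Lang.of_succ_cons_sWord_append {z : Fin k} (hz : (z : ℕ) = 0) {a : Fin k}
    (ha : (a : ℕ) + 1 < k) {w : List (Fin k)}
    (h : Lang ((⟨a + 1, ha⟩ : Fin k) :: (sWord w ++ [z]))) : Lang (a :: w) := by
  obtain ⟨b, m, hm⟩ := h.exists_infix_sWord (by simp)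
  exact ⟨b, m, infix_of_succ_cons_sWord_append_infix hz ha hm⟩

lemma mem_Attr_of_forall_Lang_pref {x : ℕ → Fin k} (h : ∀ n, Lang (pref x n)) : x ∈ Attr k := by
  intro i n
  refine (h (i + n)).of_infix ?_
  rw [pref_add]
  exact (List.suffix_append _ _).isInfix

lemma le_delta_of_Lang {x : ℕ → Fin k} {n : ℕ} (h : Lang (pref x n)) : (n : ℕ∞) ≤ delta x :=
  le_sSup ⟨n, rfl, h⟩

lemma delta_le_of_not_Lang {x : ℕ → Fin k} {n : ℕ} (h : ¬ Lang (pref x n)) : delta x ≤ n := by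
  refine sSup_le ?_
  rintro _ ⟨m, rfl, hm⟩
  rw [Nat.cast_le]
  by_contra hnm
  exact h (hm.of_infix (pref_prefix x (by omega)).isInfix)

lemma ne_nil_of_not_Lang {w : List (Fin k)} (z : Fin k) (h : ¬ Lang w) : w ≠ [] := by
  rintro rfl
  exact h ⟨z, 0, (List.nil_prefix).isInfix⟩

lemma sWord_pref_append_eq_pref {z : Fin k} (hz : (z : ℕ) = 0) (x : ℕ → Fin k) (m : ℕ) :
    sWord (pref x m) ++ [z] = pref (sSeq x) ((sWord (pref x m)).length + 1) := by
  have h : sWord (pref x (m + 1)) = pref (sSeq x) (sWord (pref x (m + 1))).length :=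
    eq_pref_of_getElem? fun i hi => getElem?_sWord_pref hi
  obtain ⟨t, ht⟩ : ∃ t, sLetter (x m) = z :: t := by
    by_cases hx : (x m : ℕ) + 1 < k
    · exact ⟨_, sLetter_of_lt hz hx⟩
    · exact ⟨_, sLetter_of_not_lt hz hx⟩
  have e : sWord (pref x (m + 1)) = (sWord (pref x m) ++ [z]) ++ t := by
    rw [pref_add, sWord_append]
    simp [sWord, ht]
  have hlen : (sWord (pref x m) ++ [z]).length = (sWord (pref x m)).length + 1 := by simp
  have hle : (sWord (pref x m) ++ [z]).length ≤ (sWord (pref x (m + 1))).length := by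
    rw [e, List.length_append (bs := t)]
    omega
  have h1 : sWord (pref x m) ++ [z] <+: pref (sSeq x) (sWord (pref x (m + 1))).length := by
    rw [← h, e]
    exact List.prefix_append _ _
  have h2 := List.prefix_of_prefix_length_le h1 (pref_prefix (sSeq x) hle)
    (by rw [length_pref])
  rw [← hlen]
  exact h2.eq_of_length (by rw [length_pref])

/-- If a prefix of `x` of length `m` is not in the language, then all the shifts of the `n`-th
image of `x` starting in the image of the first letter leave the language after an explicit
time. -/
lemma delta_shift_iterate_le {z : Fin k} (hz : (z : ℕ) = 0) (n : ℕ) {x : ℕ → Fin k} {m : ℕ}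
    (h : ¬ Lang (pref x m)) {j : ℕ} (hj : j < (sWord^[n] [x 0]).length) :
    delta (shift^[j] (sSeq^[n] x)) ≤
      (((sWord^[n] (pref x m)).length + ∑ i ∈ Finset.range n, (sWord^[i] [z]).length : ℕ) :
        ℕ∞) := by
  induction n generalizing x m j with
  | zero =>
    have : j = 0 := by simpa using hj
    subst this
    simpa [length_pref] using delta_le_of_not_Lang h
  | succ n ih =>
    have hne := ne_nil_of_not_Lang z h
    have h0 : ¬ Lang (pref (sSeq x) ((sWord (pref x m)).length + 1)) := by
      rw [← sWord_pref_append_eq_pref hz]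
      exact fun h' => h (h'.of_sWord_append hz hne)
    have e0 : (sWord^[n] (pref (sSeq x) ((sWord (pref x m)).length + 1))).length =
        (sWord^[n + 1] (pref x m)).length + (sWord^[n] [z]).length := by
      rw [← sWord_pref_append_eq_pref hz, sWord_iterate_append, List.length_append,
        ← Function.iterate_succ_apply]
    rw [Finset.sum_range_succ, Function.iterate_succ_apply]
    rcases lt_or_ge j (sWord^[n] [z]).length with hj0 | hj0
    · have := ih h0 (j := j) (by rwa [sSeq_zero hz])
      rw [e0] at this
      refine this.trans ?_
      rw [Nat.cast_le]
      omega
    · have hx : (x 0 : ℕ) + 1 < k := by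
        by_contra hx
        rw [length_sWord_iterate_succ_of_not_lt hz hx] at hj
        omega
      obtain ⟨i, rfl⟩ := Nat.exists_eq_add_of_le hj0
      rw [length_sWord_iterate_succ_of_lt hz hx] at hj
      have hs : pref (sSeq x) ((sWord (pref x m)).length + 1) =
          z :: pref (shift (sSeq x)) (sWord (pref x m)).length := by
        rw [pref_succ, sSeq_zero hz]
      have h1 : ¬ Lang (pref (shift (sSeq x)) (sWord (pref x m)).length) := by
        obtain ⟨p, rfl⟩ := Nat.exists_eq_succ_of_ne_zero
          (show m ≠ 0 by rintro rfl; exact hne rfl)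
        rw [← sWord_pref_append_eq_pref hz, Nat.succ_eq_add_one, pref_succ, sWord_cons,
          sLetter_of_lt hz hx] at hs
        simp only [List.cons_append, List.nil_append, List.cons.injEq, true_and] at hs
        rw [Nat.succ_eq_add_one, pref_succ] at h ⊢
        rw [sWord_cons, sLetter_of_lt hz hx]
        simp only [List.cons_append, List.nil_append]
        rw [← hs]
        exact fun h' => h (h'.of_succ_cons_sWord_append hz hx)
      have h2 : shift (sSeq x) 0 = ⟨x 0 + 1, hx⟩ := sSeq_one hx
      have := ih h1 (j := i) (by rw [h2]; omega)
      rw [sSeq_iterate_shift, sSeq_zero hz, ← Function.iterate_add_apply, add_comm i] at this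
      refine this.trans ?_
      rw [hs, sWord_iterate_cons, List.length_append] at e0
      rw [Nat.cast_le]
      omega

lemma Lang_pref_shift_iterate (n : ℕ) (x : ℕ → Fin k) {j N : ℕ}
    (h : j + N ≤ (sWord^[n] [x 0]).length) : Lang (pref (shift^[j] (sSeq^[n] x)) N) := by
  have e : sWord^[n] [x 0] = pref (sSeq^[n] x) (sWord^[n] [x 0]).length :=
    eq_pref_of_getElem? fun i hi => getElem?_sWord_iterate_pref n (x := x) (m := 1) hi
  have h1 : Lang (pref (sSeq^[n] x) (j + N)) :=
    ⟨x 0, n, by rw [e]; exact (pref_prefix _ h).isInfix⟩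
  refine h1.of_infix ?_
  rw [pref_shift_iterate]
  exact (List.drop_suffix _ _).isInfix

lemma isClosed_setOf_Lang_pref (N : ℕ) : IsClosed {x : ℕ → Fin k | Lang (pref x N)} := by
  have hc : Continuous fun (x : ℕ → Fin k) (i : Fin N) => x i := by fun_prop
  have e : {x : ℕ → Fin k | Lang (pref x N)} =
      (fun (x : ℕ → Fin k) (i : Fin N) => x i) ⁻¹' {f | Lang (List.ofFn f)} := by
    ext x
    have : pref x N = List.ofFn fun i : Fin N => x i := by
      refine List.ext_getElem (by simp [pref]) fun i _ _ => by simp [pref]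
    simp [this]
  rw [e]
  exact (isClosed_discrete _).preimage hc

/-- An open set containing the subshift contains every sequence with a long enough prefix in
the language. -/
lemma exists_forall_Lang_pref_mem {U : Set (ℕ → Fin k)} (hU : IsOpen U) (h : Attr k ⊆ U) :
    ∃ N, ∀ x, Lang (pref x N) → x ∈ U := by
  have hanti : Antitone fun N => {x : ℕ → Fin k | Lang (pref x N)} := by
    intro m n hmn x hx
    exact Lang.of_infix hx (pref_prefix x hmn).isInfix
  obtain ⟨N, hN⟩ := exists_subset_nhds_of_isCompact' hanti.directed_ge
    (fun N => (isClosed_setOf_Lang_pref N).isCompact) isClosed_setOf_Lang_pref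
    (U := U) (fun x hx => hU.mem_nhds (h (mem_Attr_of_forall_Lang_pref (Set.mem_iInter.1 hx))))
  exact ⟨N, fun x hx => hN hx⟩

end Words

lemma tendsto_natCast_sub_mul_div_rpow {α : ℝ} (hα1 : α < 1) {c C : ℝ}
    (hc : 0 < c) (hC : 0 < C) (N : ℝ) {M : ℕ → ℕ}
    (hM : Filter.Tendsto M Filter.atTop Filter.atTop) :
    Filter.Tendsto (fun n => ((M n : ℝ) - N) * (c / (C * (M n : ℝ)) ^ α))
      Filter.atTop Filter.atTop := by
  have hMr : Filter.Tendsto (fun n => (M n : ℝ)) Filter.atTop Filter.atTop :=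
    tendsto_natCast_atTop_atTop.comp hM
  have h1 : Filter.Tendsto (fun n => c / (2 * C ^ α) * (M n : ℝ) ^ (1 - α))
      Filter.atTop Filter.atTop :=
    ((tendsto_rpow_atTop (by linarith)).comp hMr).const_mul_atTop (by positivity)
  refine Filter.tendsto_atTop_mono' _ ?_ h1
  filter_upwards [hMr.eventually_ge_atTop (2 * N), hMr.eventually_ge_atTop 1] with n hn hn1
  have hpos : (0 : ℝ) < M n := by linarith
  have hpow : (0 : ℝ) < (M n : ℝ) ^ α := Real.rpow_pos_of_pos hpos α
  have hCpow : 0 < C ^ α := Real.rpow_pos_of_pos hC α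
  rw [Real.mul_rpow hC.le hpos.le, Real.rpow_sub hpos, Real.rpow_one]
  have e : c / (2 * C ^ α) * ((M n : ℝ) / (M n : ℝ) ^ α) =
      ((M n : ℝ) / 2) * (c / (C ^ α * (M n : ℝ) ^ α)) := by
    field_simp
  rw [e]
  gcongr
  linarith

theorem stmt11 (k : ℕ) (hk : 2 ≤ k) (α : ℝ) (hα0 : 0 < α) (hα1 : α < 1)
    (g h : (ℕ → Fin k) → ℝ) (hg : Continuous g) (hgpos : ∀ x, 0 < g x)
    (hh : Continuous h) (hh0 : ∀ x ∈ Attr k, h x = 0)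
    (V : (ℕ → Fin k) → ℝ)
    (hV : ∀ x, V x = if delta x = ⊤ then 0 else (g x + h x) / ((delta x).toNat : ℝ) ^ α)
    (hVnn : ∀ x, 0 ≤ V x)
    (x : ℕ → Fin k) (hx : x ∉ Attr k) :
    Filter.Tendsto (fun n => (Renorm^[n] V) x) Filter.atTop Filter.atTop := by
  obtain ⟨z, hz⟩ : ∃ z : Fin k, (z : ℕ) = 0 := ⟨⟨0, by omega⟩, rfl⟩
  obtain ⟨m, hm⟩ : ∃ m, ¬ Lang (pref x m) := by
    by_contra! H
    exact hx (mem_Attr_of_forall_Lang_pref H)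
  have : Nonempty (ℕ → Fin k) := ⟨x⟩
  obtain ⟨x₀, -, hx₀⟩ := isCompact_univ.exists_isMinOn Set.univ_nonempty hg.continuousOn
  have hc : 0 < g x₀ / 2 := half_pos (hgpos x₀)
  obtain ⟨N, hN⟩ := exists_forall_Lang_pref_mem (U := {y | g x₀ / 2 < g y + h y})
    (isOpen_lt continuous_const (hg.add hh)) (fun y hy => by
      have h1 : g x₀ ≤ g y := hx₀ (Set.mem_univ y)
      rw [Set.mem_ofPred_eq, hh0 y hy]
      linarith [hgpos x₀])
  set M : ℕ → ℕ := fun n => (sWord^[n] [x 0]).length with hMdef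
  have hM : Filter.Tendsto M Filter.atTop Filter.atTop := by
    refine Filter.tendsto_atTop.2 fun b => ?_
    filter_upwards [Filter.eventually_ge_atTop (2 * b)] with n hn
    have h1 := lt_length_sWord_iterate_zero hk hz n
    have h2 := length_sWord_iterate_zero_le hz n (x 0)
    simp only [hMdef]
    omega
  have hbound : ∀ n j, j < M n →
      delta (shift^[j] (sSeq^[n] x)) ≤ ((2 * (m + 2) * M n : ℕ) : ℕ∞) := by
    intro n j hj
    refine (delta_shift_iterate_le hz n hm hj).trans ?_
    rw [Nat.cast_le]
    have h1 := length_sWord_iterate_le_mul hz n (pref x m)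
    rw [length_pref] at h1
    have h2 := sum_length_sWord_iterate_le hk hz n
    have h3 := length_sWord_iterate_succ_le hz n z
    have h4 : (sWord^[n] [z]).length ≤ 2 * M n := length_sWord_iterate_zero_le hz n (x 0)
    have h5 := Nat.mul_le_mul_left (m + 2) h4
    nlinarith
  have hC : (0 : ℝ) < 2 * ((m : ℝ) + 2) := by positivity
  refine Filter.tendsto_atTop_mono' _ ?_
    (tendsto_natCast_sub_mul_div_rpow hα1 hc hC N hM)
  filter_upwards [hM.eventually_ge_atTop N] with n hn
  rw [Renorm_iterate_apply]
  have hterm : ∀ j ∈ Finset.range (M n - N),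
      g x₀ / 2 / (2 * ((m : ℝ) + 2) * (M n : ℝ)) ^ α ≤ V (shift^[j] (sSeq^[n] x)) := by
    intro j hj
    rw [Finset.mem_range] at hj
    have hb := hbound n j (by omega)
    have hlow : ((1 : ℕ) : ℕ∞) ≤ delta (shift^[j] (sSeq^[n] x)) :=
      le_delta_of_Lang (Lang_pref_shift_iterate n x (by simp only [hMdef] at hj; omega))
    have hU := hN _ (Lang_pref_shift_iterate n x (j := j) (N := N)
      (by simp only [hMdef] at hj; omega))
    rw [Set.mem_ofPred_eq] at hU
    rw [hV]
    generalize delta (shift^[j] (sSeq^[n] x)) = d at hb hlow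
    lift d to ℕ using ne_top_of_le_ne_top (ENat.natCast_ne_top _) hb
    rw [if_neg (ENat.natCast_ne_top d), ENat.toNat_natCast]
    rw [Nat.cast_le] at hb hlow
    have hd : (d : ℝ) ≤ 2 * ((m : ℝ) + 2) * (M n : ℝ) := by exact_mod_cast hb
    have hd0 : (0 : ℝ) < d := by exact_mod_cast hlow
    have hp : (0 : ℝ) < (d : ℝ) ^ α := Real.rpow_pos_of_pos hd0 α
    have hle := Real.rpow_le_rpow hd0.le hd hα0.le
    have hnum := hc.le.trans hU.le
    gcongr
  calc ((M n : ℝ) - N) * (g x₀ / 2 / (2 * ((m : ℝ) + 2) * (M n : ℝ)) ^ α)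
      = ∑ j ∈ Finset.range (M n - N), g x₀ / 2 / (2 * ((m : ℝ) + 2) * (M n : ℝ)) ^ α := by
        rw [Finset.sum_const, Finset.card_range, nsmul_eq_mul, Nat.cast_sub hn]
    _ ≤ ∑ j ∈ Finset.range (M n - N), V (shift^[j] (sSeq^[n] x)) := Finset.sum_le_sum hterm
    _ ≤ ∑ j ∈ Finset.range (M n), V (shift^[j] (sSeq^[n] x)) :=
        Finset.sum_le_sum_of_subset_of_nonneg
          (Finset.range_subset_range.2 (Nat.sub_le _ _)) fun _ _ _ => hVnn _
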